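/- If the target process Y has one-point spectrum, i.e., the spectral sup-entropy H̄(Y) and spectral inf-entropy H_(Y) both coincide with the entropy rate H(Y), and the coin process X satisfies H_(X) > 0, then the interval algorithm is asymptotically optimal for the overflow-probability criterion: R*_int(X,Y) = R*(X,Y) = H(Y)/H_(X). -/

import Mathlib

open MeasureTheory Filter
open scoped ENNReal Classical

noncomputable section

namespace RNG

variable {𝒳 𝒴 : Type*}

/-- The length-`m` prefix of an infinite sequence, as a tuple. -/
def pre (ω : ℕ → 𝒳) (m : ℕ) : Fin m → 𝒳 := fun i => ω i

/-- The length-`m` prefix of an infinite sequence, as a list. -/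
def preL (ω : ℕ → 𝒳) (m : ℕ) : List 𝒳 := (List.range m).map ω

/-- `P_{X^m}(x^m)` : the probability of the cylinder set of a finite string `x^m`,
for a process with law `μ`. -/
def cylP [MeasurableSpace 𝒳] (μ : Measure (ℕ → 𝒳)) {m : ℕ} (x : Fin m → 𝒳) : ℝ :=
  (μ {ω | ∀ i : Fin m, ω i = x i}).toReal

/-- Validity (exact generation) of an algorithm `φ` (given as a full-tree function on finite
coin strings, `none` playing the role of `⊥`): for every target value `y`, the probability
that the algorithm terminates with output `y` equals `PY y`. -/
def Valid {B : Type*} [MeasurableSpace 𝒳] (μ : Measure (ℕ → 𝒳)) (PY : B → ℝ)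
    (φ : List 𝒳 → Option B) : Prop :=
  ∀ y : B,
    (μ {ω | ∃ i : ℕ, φ (preL ω i) = some y ∧ ∀ j < i, φ (preL ω j) = none}).toReal = PY y

/-- Strict lexicographic order on strings. -/
def lexLt [LT 𝒳] {m : ℕ} (x' x : Fin m → 𝒳) : Prop :=
  ∃ i : Fin m, (∀ j : Fin m, j < i → x' j = x j) ∧ x' i < x i

/-- The subinterval of `[0,1)` assigned to the string `x` by the interval algorithm:
strings are arranged in lexicographic order, `x` receiving an interval of length `P x`. -/
def itv [LT 𝒳] [Fintype 𝒳] {m : ℕ} (P : (Fin m → 𝒳) → ℝ) (x : Fin m → 𝒳) : Set ℝ :=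
  Set.Ico (∑ x' ∈ Finset.univ.filter (fun x' => lexLt x' x), P x')
    ((∑ x' ∈ Finset.univ.filter (fun x' => lexLt x' x), P x') + P x)

/-- The interval algorithm generating `Y^n` (target law `ν`) from the coin process `μ`
has stopped after at most `m` coin symbols on the sample `ω`, i.e. the coin interval
`I_{x^m}` is contained in some target interval `J_{y^n}`. -/
def IntStopped [LinearOrder 𝒳] [Fintype 𝒳] [LinearOrder 𝒴] [Fintype 𝒴]
    [MeasurableSpace 𝒳] [MeasurableSpace 𝒴]
    (μ : Measure (ℕ → 𝒳)) (ν : Measure (ℕ → 𝒴)) (n m : ℕ) (ω : ℕ → 𝒳) : Prop :=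
  ∃ y : Fin n → 𝒴, itv (fun x : Fin m → 𝒳 => cylP μ x) (pre ω m)
      ⊆ itv (fun y' : Fin n → 𝒴 => cylP ν y') y

/-- A rate `R` is achievable by the interval algorithm:
`Pr(T_n > nR) → 0` (the stopping time `T_n` is `ℕ`-valued, so `T_n > nR ↔ T_n > ⌊nR⌋`). -/
def IntAchievable [LinearOrder 𝒳] [Fintype 𝒳] [LinearOrder 𝒴] [Fintype 𝒴]
    [MeasurableSpace 𝒳] [MeasurableSpace 𝒴]
    (μ : Measure (ℕ → 𝒳)) (ν : Measure (ℕ → 𝒴)) (R : ℝ) : Prop :=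
  0 ≤ R ∧ Tendsto (fun n : ℕ =>
      (μ {ω | ¬ IntStopped μ ν n ⌊(n : ℝ) * R⌋₊ ω}).toReal) atTop (nhds 0)

/-- `R⋆_int(X,Y)` : the infimum rate achievable by the interval algorithm. -/
def Rint [LinearOrder 𝒳] [Fintype 𝒳] [LinearOrder 𝒴] [Fintype 𝒴]
    [MeasurableSpace 𝒳] [MeasurableSpace 𝒴]
    (μ : Measure (ℕ → 𝒳)) (ν : Measure (ℕ → 𝒴)) : ℝ :=
  sInf {R : ℝ | IntAchievable μ ν R}

/-- A rate `R` is achievable by some sequence of valid algorithms: for each `n` there is a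
valid algorithm `φ n` generating `Y^n` and `Pr(T_n > nR) → 0`. -/
def Achievable [MeasurableSpace 𝒳] [MeasurableSpace 𝒴]
    (μ : Measure (ℕ → 𝒳)) (ν : Measure (ℕ → 𝒴)) (R : ℝ) : Prop :=
  0 ≤ R ∧ ∃ φ : (n : ℕ) → List 𝒳 → Option (Fin n → 𝒴),
    (∀ n : ℕ, Valid μ (fun y : Fin n → 𝒴 => cylP ν y) (φ n)) ∧
    Tendsto (fun n : ℕ =>
      (μ {ω | ∀ i ≤ ⌊(n : ℝ) * R⌋₊, φ n (preL ω i) = none}).toReal) atTop (nhds 0)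

/-- `R⋆(X,Y)` : the infimum rate achievable over all valid algorithms. -/
def Rstar [MeasurableSpace 𝒳] [MeasurableSpace 𝒴]
    (μ : Measure (ℕ → 𝒳)) (ν : Measure (ℕ → 𝒴)) : ℝ :=
  sInf {R : ℝ | Achievable μ ν R}

/-- The expected stopping time `E[T_n]` of the interval algorithm, via `E[T] = ∑_m Pr(T>m)`. -/
def intAvgT [LinearOrder 𝒳] [Fintype 𝒳] [LinearOrder 𝒴] [Fintype 𝒴]
    [MeasurableSpace 𝒳] [MeasurableSpace 𝒴]
    (μ : Measure (ℕ → 𝒳)) (ν : Measure (ℕ → 𝒴)) (n : ℕ) : ℝ≥0∞ :=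
  ∑' m : ℕ, μ {ω | ¬ IntStopped μ ν n m ω}

/-- A rate `L` is average achievable by the interval algorithm: `limsup E[T_n]/n ≤ L`. -/
def IntAvgAchievable [LinearOrder 𝒳] [Fintype 𝒳] [LinearOrder 𝒴] [Fintype 𝒴]
    [MeasurableSpace 𝒳] [MeasurableSpace 𝒴]
    (μ : Measure (ℕ → 𝒳)) (ν : Measure (ℕ → 𝒴)) (L : ℝ≥0∞) : Prop :=
  limsup (fun n : ℕ => intAvgT μ ν n / (n : ℝ≥0∞)) atTop ≤ L

/-- `L⋆_int(X,Y)` : the infimum average achievable rate of the interval algorithm. -/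
def Lint [LinearOrder 𝒳] [Fintype 𝒳] [LinearOrder 𝒴] [Fintype 𝒴]
    [MeasurableSpace 𝒳] [MeasurableSpace 𝒴]
    (μ : Measure (ℕ → 𝒳)) (ν : Measure (ℕ → 𝒴)) : ℝ≥0∞ :=
  sInf {L : ℝ≥0∞ | IntAvgAchievable μ ν L}

/-- A rate `L` is average achievable by some sequence of valid algorithms. -/
def AvgAchievable [MeasurableSpace 𝒳] [MeasurableSpace 𝒴]
    (μ : Measure (ℕ → 𝒳)) (ν : Measure (ℕ → 𝒴)) (L : ℝ≥0∞) : Prop :=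
  ∃ φ : (n : ℕ) → List 𝒳 → Option (Fin n → 𝒴),
    (∀ n : ℕ, Valid μ (fun y : Fin n → 𝒴 => cylP ν y) (φ n)) ∧
    limsup (fun n : ℕ =>
      (∑' m : ℕ, μ {ω | ∀ i ≤ m, φ n (preL ω i) = none}) / (n : ℝ≥0∞)) atTop ≤ L

/-- `L⋆(X,Y)` : the infimum average achievable rate over all valid algorithms. -/
def Lstar [MeasurableSpace 𝒳] [MeasurableSpace 𝒴]
    (μ : Measure (ℕ → 𝒳)) (ν : Measure (ℕ → 𝒴)) : ℝ≥0∞ :=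
  sInf {L : ℝ≥0∞ | AvgAchievable μ ν L}

/-- The spectral sup-entropy `H̄(X)`: the event `(1/m) log(1/P_{X^m}(X^m)) ≥ λ` is
`P_{X^m}(X^m) ≤ 2^{-mλ}`. -/
def specSup [MeasurableSpace 𝒳] (μ : Measure (ℕ → 𝒳)) : ℝ :=
  sInf {lam : ℝ | Tendsto (fun m : ℕ =>
    (μ {ω | cylP μ (pre ω m) ≤ (2 : ℝ) ^ (-((m : ℝ) * lam))}).toReal) atTop (nhds 0)}

/-- The spectral inf-entropy `H̲(X)`: the event `(1/m) log(1/P_{X^m}(X^m)) ≤ λ` is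
`P_{X^m}(X^m) ≥ 2^{-mλ}`. -/
def specInf [MeasurableSpace 𝒳] (μ : Measure (ℕ → 𝒳)) : ℝ :=
  sSup {lam : ℝ | Tendsto (fun m : ℕ =>
    (μ {ω | (2 : ℝ) ^ (-((m : ℝ) * lam)) ≤ cylP μ (pre ω m)}).toReal) atTop (nhds 0)}

/-- The (sup-)entropy rate `H(X) = limsup (1/m) H(X^m)`. -/
def entRate [MeasurableSpace 𝒳] [Fintype 𝒳] (μ : Measure (ℕ → 𝒳)) : ℝ :=
  limsup (fun m : ℕ =>
    (∑ x : Fin m → 𝒳, cylP μ x * Real.logb 2 (1 / cylP μ x)) / (m : ℝ)) atTop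

/-- Upper-tail condition: `Pr((1/m) log(1/P_{X^m}(X^m)) ≥ H̄(X)+δ) ≤ K/m²` eventually. -/
def UpperTail [MeasurableSpace 𝒳] (μ : Measure (ℕ → 𝒳)) : Prop :=
  ∀ δ : ℝ, 0 < δ → ∃ (K : ℝ) (m₀ : ℕ), ∀ m : ℕ, m₀ ≤ m →
    (μ {ω | cylP μ (pre ω m) ≤ (2 : ℝ) ^ (-((m : ℝ) * (specSup μ + δ)))}).toReal
      ≤ K / (m : ℝ) ^ 2

/-- Lower-tail condition: `Pr((1/m) log(1/P_{X^m}(X^m)) ≤ H̲(X)−δ) ≤ K/m²` eventually. -/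
def LowerTail [MeasurableSpace 𝒳] (μ : Measure (ℕ → 𝒳)) : Prop :=
  ∀ δ : ℝ, 0 < δ → ∃ (K : ℝ) (m₀ : ℕ), ∀ m : ℕ, m₀ ≤ m →
    (μ {ω | (2 : ℝ) ^ (-((m : ℝ) * (specInf μ - δ))) ≤ cylP μ (pre ω m)}).toReal
      ≤ K / (m : ℝ) ^ 2

/-- The finite-dimensional distributions of a Markov chain with initial distribution `q`
and transition matrix `W` (`W x x'` is the transition probability from `x` to `x'`). -/
def markovP (q : 𝒳 → ℝ) (W : 𝒳 → 𝒳 → ℝ) : (m : ℕ) → (Fin m → 𝒳) → ℝ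
  | 0, _ => 1
  | m + 1, x => q (x 0) * ∏ i : Fin m, W (x i.castSucc) (x i.succ)

/-- `μ` is the law of the Markov chain with initial distribution `q` and transition matrix `W`. -/
def IsMarkovMeasure [MeasurableSpace 𝒳] (μ : Measure (ℕ → 𝒳)) (q : 𝒳 → ℝ)
    (W : 𝒳 → 𝒳 → ℝ) : Prop :=
  ∀ (m : ℕ) (x : Fin m → 𝒳), cylP μ x = markovP q W m x

/-- `W` is a (row-)stochastic transition matrix. -/
def IsTransMat [Fintype 𝒳] (W : 𝒳 → 𝒳 → ℝ) : Prop :=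
  (∀ x x', 0 ≤ W x x') ∧ ∀ x, ∑ x', W x x' = 1

/-- Irreducibility: any state reaches any other in some `k ≥ 1` steps. -/
def IrreducibleMat [Fintype 𝒳] [DecidableEq 𝒳] (W : Matrix 𝒳 𝒳 ℝ) : Prop :=
  ∀ x x' : 𝒳, ∃ k : ℕ, 1 ≤ k ∧ 0 < (W ^ k) x x'

/-- `π` is a stationary distribution of `W`. -/
def IsStationary [Fintype 𝒳] (π : 𝒳 → ℝ) (W : 𝒳 → 𝒳 → ℝ) : Prop :=
  (∀ x, 0 ≤ π x) ∧ (∑ x, π x = 1) ∧ ∀ x, ∑ x', π x' * W x' x = π x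

/-- `q` is a probability distribution (initial distribution). -/
def IsInitial [Fintype 𝒳] (q : 𝒳 → ℝ) : Prop :=
  (∀ x, 0 ≤ q x) ∧ ∑ x, q x = 1

/-- The entropy rate `H^W(X) = Σ_{x',x} π(x') W(x|x') log (1/W(x|x'))` of a stationary
Markov chain. -/
def matEnt [Fintype 𝒳] (π : 𝒳 → ℝ) (W : 𝒳 → 𝒳 → ℝ) : ℝ :=
  ∑ x' : 𝒳, ∑ x : 𝒳, π x' * W x' x * Real.logb 2 (1 / W x' x)

/-- The weight `w(ξ) = Pr(Y_1 ∈ 𝒴_ξ)` of the irreducible class `ξ` under the initial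
distribution `q`, where `c` assigns to each state its class. -/
def wgt [Fintype 𝒴] {r : ℕ} (c : 𝒴 → Fin r) (q : 𝒴 → ℝ) (ξ : Fin r) : ℝ :=
  ∑ y ∈ Finset.univ.filter (fun y => c y = ξ), q y

/-- The binary entropy function (base 2). -/
def binEnt (t : ℝ) : ℝ := t * Real.logb 2 (1 / t) + (1 - t) * Real.logb 2 (1 / (1 - t))

end RNG

open RNG

namespace RNG

variable {𝒳 𝒴 : Type*}

section Cylinder

theorem cylP_nonneg [MeasurableSpace 𝒳] (μ : Measure (ℕ → 𝒳)) {m : ℕ} (x : Fin m → 𝒳) : 0 ≤ cylP μ x :=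
  ENNReal.toReal_nonneg

theorem setOf_forall_eq_pre {m : ℕ} (x : Fin m → 𝒳) :
    {ω : ℕ → 𝒳 | ∀ i : Fin m, ω i = x i} = {ω | pre ω m = x} := by
  ext ω
  simp [pre, funext_iff]

theorem measurable_pre [MeasurableSpace 𝒳] (m : ℕ) : Measurable (fun ω : ℕ → 𝒳 => pre ω m) :=
  measurable_pi_lambda _ fun i => measurable_pi_apply (i : ℕ)

theorem preL_congr {ω ω' : ℕ → 𝒳} {i m : ℕ} (him : i ≤ m) (h : pre ω m = pre ω' m) :
    preL ω i = preL ω' i := by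
  refine List.map_congr_left fun j hj => ?_
  exact congrFun h ⟨j, (List.mem_range.1 hj).trans_le him⟩

variable [Fintype 𝒳] [MeasurableSpace 𝒳] [DiscreteMeasurableSpace 𝒳]
  (μ : Measure (ℕ → 𝒳)) [IsProbabilityMeasure μ]

theorem toReal_setOf_pre {m : ℕ} (p : (Fin m → 𝒳) → Prop) [DecidablePred p] :
    (μ {ω | p (pre ω m)}).toReal = ∑ x ∈ Finset.univ.filter p, cylP μ x := by
  have hunion : {ω | p (pre ω m)} =
      ⋃ x ∈ Finset.univ.filter p, (fun ω : ℕ → 𝒳 => pre ω m) ⁻¹' {x} := by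
    ext ω
    simp
  have hmeas : ∀ x : Fin m → 𝒳, MeasurableSet ((fun ω : ℕ → 𝒳 => pre ω m) ⁻¹' {x}) :=
    fun x => measurable_pre m (measurableSet_singleton x)
  rw [hunion, measure_biUnion_finset _ fun x _ => hmeas x,
    ENNReal.toReal_sum fun x _ => measure_ne_top _ _]
  · refine Finset.sum_congr rfl fun x _ => ?_
    rw [cylP, setOf_forall_eq_pre]
    rfl
  · intro x _ y _ hxy
    exact Disjoint.preimage _ (Set.disjoint_singleton.2 hxy)

theorem sum_cylP (m : ℕ) : ∑ x : Fin m → 𝒳, cylP μ x = 1 := by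
  have h := toReal_setOf_pre μ (m := m) fun _ => True
  simpa using h.symm

theorem cylP_le_one {m : ℕ} (x : Fin m → 𝒳) : cylP μ x ≤ 1 := by
  rw [← sum_cylP μ m]
  exact Finset.single_le_sum (fun y _ => cylP_nonneg μ y) (Finset.mem_univ x)

end Cylinder

section Lex

variable [LinearOrder 𝒳] {m : ℕ}

theorem lexLt_trichotomy (x y : Fin m → 𝒳) : lexLt x y ∨ x = y ∨ lexLt y x :=
  lt_trichotomy (toLex x) (toLex y)

theorem lexLt_irrefl (x : Fin m → 𝒳) : ¬ lexLt x x := lt_irrefl (toLex x)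

theorem lexLt.trans {x y z : Fin m → 𝒳} (h₁ : lexLt x y) (h₂ : lexLt y z) : lexLt x z :=
  lt_trans (a := toLex x) (b := toLex y) (c := toLex z) h₁ h₂

theorem lexLt.pre_mono {ω ω' : ℕ → 𝒳} {i m : ℕ} (him : i ≤ m)
    (h : lexLt (pre ω i) (pre ω' i)) : lexLt (pre ω m) (pre ω' m) := by
  obtain ⟨k, hk, hlt⟩ := h
  refine ⟨⟨k, k.2.trans_le him⟩, fun j hj => ?_, hlt⟩
  exact hk ⟨j, lt_trans (Fin.lt_def.1 hj) k.2⟩ (Fin.lt_def.2 (Fin.lt_def.1 hj))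

variable [Fintype 𝒳] {P : (Fin m → 𝒳) → ℝ}

/-- The left endpoint of the interval assigned to a string. -/
def itvLeft (P : (Fin m → 𝒳) → ℝ) (x : Fin m → 𝒳) : ℝ :=
  ∑ x' ∈ Finset.univ.filter (fun x' => lexLt x' x), P x'

theorem itv_eq (P : (Fin m → 𝒳) → ℝ) (x : Fin m → 𝒳) :
    itv P x = Set.Ico (itvLeft P x) (itvLeft P x + P x) := rfl

theorem itvLeft_add (P : (Fin m → 𝒳) → ℝ) (x : Fin m → 𝒳) :
    itvLeft P x + P x = ∑ x' ∈ Finset.univ.filter (fun x' => lexLt x' x ∨ x' = x), P x' := by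
  rw [Finset.filter_or, Finset.sum_union]
  · simp [itvLeft, Finset.filter_eq']
  · refine Finset.disjoint_filter.2 fun y _ h h' => ?_
    subst h'
    exact lexLt_irrefl _ h

theorem itvLeft_add_le (hP : ∀ x, 0 ≤ P x) {x y : Fin m → 𝒳} (h : lexLt x y) :
    itvLeft P x + P x ≤ itvLeft P y := by
  rw [itvLeft_add]
  refine Finset.sum_le_sum_of_subset_of_nonneg (fun z hz => ?_) fun z _ _ => hP z
  simp only [Finset.mem_filter, Finset.mem_univ, true_and] at hz ⊢
  rcases hz with hz | rfl
  exacts [hz.trans h, h]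

theorem pairwise_disjoint_itv (hP : ∀ x, 0 ≤ P x) : Pairwise (Function.onFun Disjoint (itv P)) := by
  intro x y hxy
  rw [Function.onFun, itv_eq, itv_eq, Set.disjoint_left]
  rintro t ⟨h₁, h₂⟩ ⟨h₃, h₄⟩
  rcases lexLt_trichotomy x y with h | h | h
  · linarith [itvLeft_add_le hP h]
  · exact hxy h
  · linarith [itvLeft_add_le hP h]

theorem itv_subset_Ico (hP : ∀ x, 0 ≤ P x) (x : Fin m → 𝒳) :
    itv P x ⊆ Set.Ico 0 (∑ y, P y) := by
  rw [itv_eq]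
  refine Set.Ico_subset_Ico (Finset.sum_nonneg fun y _ => hP y) ?_
  rw [itvLeft_add]
  exact Finset.sum_le_sum_of_subset_of_nonneg (Finset.subset_univ _) fun y _ _ => hP y

theorem measurableSet_itv (P : (Fin m → 𝒳) → ℝ) (x : Fin m → 𝒳) : MeasurableSet (itv P x) :=
  measurableSet_Ico

theorem volume_itv (P : (Fin m → 𝒳) → ℝ) (x : Fin m → 𝒳) :
    volume (itv P x) = ENNReal.ofReal (P x) := by
  rw [itv_eq, Real.volume_Ico]
  congr 1
  ring

theorem volume_biUnion_itv (hP : ∀ x, 0 ≤ P x) (S : Finset (Fin m → 𝒳)) :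
    volume (⋃ x ∈ S, itv P x) = ENNReal.ofReal (∑ x ∈ S, P x) := by
  rw [measure_biUnion_finset (fun x _ y _ hxy => pairwise_disjoint_itv hP hxy)
    fun x _ => measurableSet_itv P x, ENNReal.ofReal_sum_of_nonneg fun x _ => hP x]
  exact Finset.sum_congr rfl fun x _ => volume_itv P x

/-- The intervals assigned to the strings exhaust `[0, ∑ P)` up to a null set. -/
theorem volume_Ico_diff_iUnion_itv (hP : ∀ x, 0 ≤ P x) :
    volume (Set.Ico 0 (∑ y, P y) \ ⋃ x ∈ (Finset.univ : Finset (Fin m → 𝒳)), itv P x) = 0 := by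
  rw [measure_sdiff (Set.iUnion₂_subset fun x _ => itv_subset_Ico hP x)
    (Finset.measurableSet_biUnion _ fun x _ => measurableSet_itv P x).nullMeasurableSet,
    volume_biUnion_itv hP, Real.volume_Ico]
  · simp
  · rw [volume_biUnion_itv hP]
    exact ENNReal.ofReal_ne_top

end Lex

/-- An interval of length at most `ε` meeting `[l, r)` without being contained in it lies within
`ε` of an endpoint of `[l, r)`. -/
theorem Ico_subset_of_not_subset_Ico {a b l r t ε : ℝ} (hlen : b - a ≤ ε)
    (ht : t ∈ Set.Ico a b) (ht' : t ∈ Set.Ico l r) (hn : ¬ Set.Ico a b ⊆ Set.Ico l r) :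
    Set.Ico a b ⊆ Set.Icc (l - ε) (l + ε) ∪ Set.Icc (r - ε) (r + ε) := by
  obtain ⟨s, ⟨hs₁, hs₂⟩, hs⟩ := Set.not_subset.1 hn
  obtain ⟨h₁, h₂⟩ := ht
  obtain ⟨h₃, h₄⟩ := ht'
  rintro u ⟨hu₁, hu₂⟩
  by_cases hl : l ≤ s
  · have hr : r ≤ s := not_lt.1 fun h => hs ⟨hl, h⟩
    exact Or.inr ⟨by linarith, by linarith⟩
  · rw [not_le] at hl
    exact Or.inl ⟨by linarith, by linarith⟩

section Algorithm

variable [Fintype 𝒳] [LinearOrder 𝒳] [MeasurableSpace 𝒳]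
  [Fintype 𝒴] [LinearOrder 𝒴] [MeasurableSpace 𝒴]
  (μ : Measure (ℕ → 𝒳)) (ν : Measure (ℕ → 𝒴))

/-- The interval algorithm as a function on finite coin strings. -/
def intAlg (n : ℕ) (l : List 𝒳) : Option (Fin n → 𝒴) :=
  if h : ∃ y : Fin n → 𝒴, itv (fun x : Fin l.length → 𝒳 => cylP μ x) l.get
      ⊆ itv (fun y' : Fin n → 𝒴 => cylP ν y') y
  then some h.choose else none

theorem itv_get_preL (ω : ℕ → 𝒳) (m : ℕ) :
    itv (fun x : Fin (preL ω m).length → 𝒳 => cylP μ x) (preL ω m).get =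
      itv (fun x : Fin m → 𝒳 => cylP μ x) (pre ω m) := by
  have key : ∀ (k : ℕ) (f : Fin k → 𝒳) (hk : k = m), (∀ i, f i = ω i) →
      itv (fun x : Fin k → 𝒳 => cylP μ x) f = itv (fun x : Fin m → 𝒳 => cylP μ x) (pre ω m) := by
    rintro k f rfl hf
    rw [show f = pre ω k from funext hf]
  exact key _ _ (by simp [preL]) fun i => (List.get_eq_getElem ..).trans (by simp [preL])

theorem intAlg_preL_eq_none_iff (n m : ℕ) (ω : ℕ → 𝒳) :
    intAlg μ ν n (preL ω m) = none ↔ ¬ IntStopped μ ν n m ω := by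
  simp only [intAlg, itv_get_preL, IntStopped, dite_eq_right_iff, reduceCtorEq, imp_false]

theorem itv_subset_of_intAlg_eq_some {n m : ℕ} {ω : ℕ → 𝒳} {y : Fin n → 𝒴}
    (h : intAlg μ ν n (preL ω m) = some y) :
    itv (fun x : Fin m → 𝒳 => cylP μ x) (pre ω m) ⊆ itv (fun y' : Fin n → 𝒴 => cylP ν y') y := by
  unfold intAlg at h
  split_ifs at h with hex
  rw [← Option.some.inj h, ← itv_get_preL]
  exact hex.choose_spec

end Algorithm

section Interval

variable [Fintype 𝒳] [LinearOrder 𝒳] [MeasurableSpace 𝒳] [DiscreteMeasurableSpace 𝒳]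
  [Fintype 𝒴] [LinearOrder 𝒴] [MeasurableSpace 𝒴] [DiscreteMeasurableSpace 𝒴]
  (μ : Measure (ℕ → 𝒳)) [IsProbabilityMeasure μ] (ν : Measure (ℕ → 𝒴)) [IsProbabilityMeasure ν]

theorem measure_itv_subset_le (m : ℕ) (W : Set ℝ) :
    μ {ω | itv (fun x : Fin m → 𝒳 => cylP μ x) (pre ω m) ⊆ W} ≤ volume W := by
  rw [← ENNReal.ofReal_toReal (measure_ne_top μ _),
    toReal_setOf_pre μ (fun x : Fin m → 𝒳 => itv (fun x : Fin m → 𝒳 => cylP μ x) x ⊆ W),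
    ← volume_biUnion_itv fun x => cylP_nonneg μ x]
  refine measure_mono (Set.iUnion₂_subset fun x hx => ?_)
  simpa using hx

theorem itv_pre_anti {i m : ℕ} (him : i ≤ m) (ω : ℕ → 𝒳) :
    itv (fun x : Fin m → 𝒳 => cylP μ x) (pre ω m) ⊆
      itv (fun x : Fin i → 𝒳 => cylP μ x) (pre ω i) := by
  rw [itv_eq, itv_eq]
  refine Set.Ico_subset_Ico ?_ ?_
  · rw [itvLeft, itvLeft, ← toReal_setOf_pre μ, ← toReal_setOf_pre μ]
    exact ENNReal.toReal_mono (measure_ne_top _ _) (measure_mono fun ω' h => h.pre_mono him)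
  · rw [itvLeft_add, itvLeft_add, ← toReal_setOf_pre μ fun x => lexLt x (pre ω m) ∨ x = pre ω m,
      ← toReal_setOf_pre μ fun x => lexLt x (pre ω i) ∨ x = pre ω i]
    refine ENNReal.toReal_mono (measure_ne_top _ _) (measure_mono fun ω' h => ?_)
    rcases lexLt_trichotomy (pre ω' i) (pre ω i) with h' | h' | h'
    · exact Or.inl h'
    · exact Or.inr h'
    · have h'' := h'.pre_mono him
      rcases h with h | h
      · exact (lexLt_irrefl _ (h.trans h'')).elim
      · rw [h] at h''
        exact (lexLt_irrefl _ h'').elim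

/-- Overflow bound for the interval algorithm: `G` is a set of target strings to be
separated at resolution `ε`. -/
theorem toReal_not_intStopped_le (n m : ℕ) {ε : ℝ} (hε : 0 ≤ ε) (G : Finset (Fin n → 𝒴)) :
    (μ {ω | ¬ IntStopped μ ν n m ω}).toReal ≤
      (μ {ω | ε ≤ cylP μ (pre ω m)}).toReal + ∑ y ∈ Gᶜ, cylP ν y + 4 * (G.card * ε) := by
  set Q : (Fin n → 𝒴) → ℝ := fun y => cylP ν y with hQdef
  have hQ : ∀ y, 0 ≤ Q y := fun y => cylP_nonneg ν y
  set V : (Fin n → 𝒴) → Set ℝ := fun y =>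
    Set.Icc (itvLeft Q y - ε) (itvLeft Q y + ε) ∪
      Set.Icc (itvLeft Q y + Q y - ε) (itvLeft Q y + Q y + ε) with hV
  set N : Set ℝ := Set.Ico 0 (∑ y, Q y) \ ⋃ y ∈ (Finset.univ : Finset (Fin n → 𝒴)), itv Q y
    with hN
  set W : Set ℝ := (N ∪ ⋃ y ∈ Gᶜ, itv Q y) ∪ ⋃ y ∈ G, V y with hW
  have hsub : {ω | ¬ IntStopped μ ν n m ω} ⊆ {ω | ε ≤ cylP μ (pre ω m)} ∪
      {ω | itv (fun x : Fin m → 𝒳 => cylP μ x) (pre ω m) ⊆ W} := by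
    intro ω hω
    by_cases hlen : ε ≤ cylP μ (pre ω m)
    · exact Or.inl hlen
    refine Or.inr fun t ht => ?_
    have ht01 : t ∈ Set.Ico (0 : ℝ) (∑ y, Q y) := by
      rw [hQdef, sum_cylP ν n, ← sum_cylP μ m]
      exact itv_subset_Ico (fun x => cylP_nonneg μ x) _ ht
    by_cases hcov : t ∈ ⋃ y ∈ (Finset.univ : Finset (Fin n → 𝒴)), itv Q y
    · simp only [Finset.mem_univ, Set.iUnion_true, Set.mem_iUnion] at hcov
      obtain ⟨y, hy⟩ := hcov
      by_cases hyG : y ∈ G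
      · refine Or.inr (Set.mem_biUnion hyG ?_)
        refine Ico_subset_of_not_subset_Ico ?_ ht hy (fun h => hω ⟨y, h⟩) ht
        simp only [add_sub_cancel_left]
        exact (not_le.1 hlen).le
      · exact Or.inl (Or.inr (Set.mem_biUnion (Finset.mem_coe.2 (Finset.mem_compl.2 hyG)) hy))
    · exact Or.inl (Or.inl ⟨ht01, hcov⟩)
  have hVvol : ∀ y, volume (V y) ≤ ENNReal.ofReal (4 * ε) := fun y => by
    refine (measure_union_le _ _).trans ?_
    rw [Real.volume_Icc, Real.volume_Icc, ← ENNReal.ofReal_add (by linarith) (by linarith)]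
    exact ENNReal.ofReal_le_ofReal (by linarith)
  have hWvol : volume W ≤ ENNReal.ofReal (∑ y ∈ Gᶜ, Q y + 4 * (G.card * ε)) := by
    calc volume W ≤ (volume N + volume (⋃ y ∈ Gᶜ, itv Q y)) + volume (⋃ y ∈ G, V y) :=
          (measure_union_le _ _).trans (add_le_add_left (measure_union_le _ _) _)
      _ ≤ (0 + ENNReal.ofReal (∑ y ∈ Gᶜ, Q y)) + ∑ y ∈ G, ENNReal.ofReal (4 * ε) :=
          add_le_add (add_le_add (volume_Ico_diff_iUnion_itv hQ).le (volume_biUnion_itv hQ _).le)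
            ((measure_biUnion_finset_le _ _).trans (Finset.sum_le_sum fun y _ => hVvol y))
      _ = ENNReal.ofReal (∑ y ∈ Gᶜ, Q y + 4 * (G.card * ε)) := by
          rw [zero_add, ← ENNReal.ofReal_sum_of_nonneg fun _ _ => by positivity,
            ← ENNReal.ofReal_add (Finset.sum_nonneg fun y _ => hQ y)
              (Finset.sum_nonneg fun _ _ => by positivity)]
          congr 2
          rw [Finset.sum_const, nsmul_eq_mul]
          ring
  have hpos : 0 ≤ ∑ y ∈ Gᶜ, Q y + 4 * (G.card * ε) :=
    add_nonneg (Finset.sum_nonneg fun y _ => hQ y) (by positivity)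
  have hmain := (measure_mono hsub).trans <| (measure_union_le _ _).trans <|
    add_le_add_right ((measure_itv_subset_le μ m W).trans hWvol) _
  have hreal := ENNReal.toReal_mono
    (ENNReal.add_ne_top.2 ⟨measure_ne_top _ _, ENNReal.ofReal_ne_top⟩) hmain
  rwa [ENNReal.toReal_add (measure_ne_top _ _) ENNReal.ofReal_ne_top,
    ENNReal.toReal_ofReal hpos, ← add_assoc] at hreal

/-- The interval algorithm is valid as soon as it stops almost surely. -/
theorem valid_intAlg (n : ℕ)
    (hlim : Tendsto (fun m => (μ {ω | ¬ IntStopped μ ν n m ω}).toReal) atTop (nhds 0)) :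
    Valid μ (fun y : Fin n → 𝒴 => cylP ν y) (intAlg μ ν n) := by
  set E : (Fin n → 𝒴) → Set (ℕ → 𝒳) := fun y =>
    {ω | ∃ i : ℕ, intAlg μ ν n (preL ω i) = some y ∧ ∀ j < i, intAlg μ ν n (preL ω j) = none}
    with hE
  have hle : ∀ y, (μ (E y)).toReal ≤ cylP ν y := by
    intro y
    set S : ℕ → Set (ℕ → 𝒳) := fun m => {ω | ∃ i ≤ m, intAlg μ ν n (preL ω i) = some y} with hS
    have hmono : Monotone S := fun a b hab ω ⟨i, hi, h⟩ => ⟨i, hi.trans hab, h⟩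
    have hES : E y ⊆ ⋃ m, S m := fun ω ⟨i, h, _⟩ => Set.mem_iUnion.2 ⟨i, i, le_rfl, h⟩
    have hSle : ∀ m, μ (S m) ≤ ENNReal.ofReal (cylP ν y) := by
      intro m
      rw [← volume_itv (fun y' : Fin n → 𝒴 => cylP ν y') y]
      refine le_trans (measure_mono ?_) (measure_itv_subset_le μ m _)
      rintro ω ⟨i, hi, h⟩
      exact (itv_pre_anti μ hi ω).trans (itv_subset_of_intAlg_eq_some μ ν h)
    refine ENNReal.toReal_le_of_le_ofReal (cylP_nonneg ν y) ((measure_mono hES).trans ?_)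
    rw [hmono.measure_iUnion]
    exact iSup_le hSle
  have hcompl : (μ {ω | ∀ i, intAlg μ ν n (preL ω i) = none}).toReal = 0 := by
    refine le_antisymm (ge_of_tendsto' hlim fun m => ?_) ENNReal.toReal_nonneg
    refine ENNReal.toReal_mono (measure_ne_top _ _) (measure_mono fun ω hω => ?_)
    exact (intAlg_preL_eq_none_iff μ ν n m ω).1 (hω m)
  have hcover : (Set.univ : Set (ℕ → 𝒳)) ⊆
      {ω | ∀ i, intAlg μ ν n (preL ω i) = none} ∪ ⋃ y ∈ Finset.univ, E y := by
    intro ω _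
    by_cases h : ∀ i, intAlg μ ν n (preL ω i) = none
    · exact Or.inl h
    · push Not at h
      obtain ⟨y, hy⟩ := Option.ne_none_iff_exists'.1 (Nat.find_spec h)
      refine Or.inr (Set.mem_biUnion (Finset.mem_coe.2 (Finset.mem_univ y)) ⟨Nat.find h, hy, ?_⟩)
      exact fun j hj => not_not.1 (Nat.find_min h hj)
  have hsum : 1 ≤ ∑ y, (μ (E y)).toReal := by
    have h₁ : (1 : ℝ≥0∞) ≤ 0 + ∑ y, μ (E y) := by
      rw [← measure_univ (μ := μ)]
      refine (measure_mono hcover).trans ((measure_union_le _ _).trans ?_)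
      refine add_le_add (le_of_eq ?_) (measure_biUnion_finset_le _ _)
      exact (ENNReal.toReal_eq_zero_iff _).1 hcompl |>.resolve_right (measure_ne_top _ _)
    rw [zero_add] at h₁
    have h₂ := ENNReal.toReal_mono (ENNReal.sum_ne_top.2 fun y _ => measure_ne_top _ _) h₁
    rwa [ENNReal.toReal_one, ENNReal.toReal_sum fun y _ => measure_ne_top _ _] at h₂
  have heq := (Finset.sum_eq_sum_iff_of_le fun y _ => hle y).1
    (le_antisymm (Finset.sum_le_sum fun y _ => hle y) ((sum_cylP ν n).trans_le hsum))
  exact fun y => heq y (Finset.mem_univ y)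

end Interval

section Spectrum

theorem two_rpow_neg_anti (m : ℕ) {a b : ℝ} (hab : a ≤ b) :
    (2 : ℝ) ^ (-((m : ℝ) * b)) ≤ (2 : ℝ) ^ (-((m : ℝ) * a)) :=
  Real.rpow_le_rpow_of_exponent_le one_le_two
    (neg_le_neg (mul_le_mul_of_nonneg_left hab m.cast_nonneg))

theorem tendsto_two_rpow_neg {c : ℝ} (hc : 0 < c) :
    Tendsto (fun n : ℕ => (2 : ℝ) ^ (-((n : ℝ) * c))) atTop (nhds 0) := by
  have h : (fun n : ℕ => (2 : ℝ) ^ (-((n : ℝ) * c))) = fun n : ℕ => ((2 : ℝ) ^ (-c)) ^ n := by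
    funext n
    rw [← Real.rpow_natCast, ← Real.rpow_mul zero_le_two]
    congr 1
    ring
  rw [h]
  exact tendsto_pow_atTop_nhds_zero_of_lt_one (by positivity)
    (Real.rpow_lt_one_of_one_lt_of_neg one_lt_two (neg_lt_zero.2 hc))

variable [MeasurableSpace 𝒳] (μ : Measure (ℕ → 𝒳))

theorem tendsto_of_lt_specInf [IsProbabilityMeasure μ] (hpos : 0 < specInf μ) {a : ℝ} (ha : a < specInf μ) :
    Tendsto (fun m : ℕ => (μ {ω | (2 : ℝ) ^ (-((m : ℝ) * a)) ≤ cylP μ (pre ω m)}).toReal)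
      atTop (nhds 0) := by
  have hne : Set.Nonempty {lam : ℝ | Tendsto (fun m : ℕ =>
      (μ {ω | (2 : ℝ) ^ (-((m : ℝ) * lam)) ≤ cylP μ (pre ω m)}).toReal) atTop (nhds 0)} := by
    by_contra h
    rw [specInf, Set.not_nonempty_iff_eq_empty.1 h, Real.sSup_empty] at hpos
    exact hpos.false
  obtain ⟨b, hb, hab⟩ := exists_lt_of_lt_csSup hne ha
  refine squeeze_zero (fun m => ENNReal.toReal_nonneg) (fun m => ?_) hb
  exact ENNReal.toReal_mono (measure_ne_top _ _)
    (measure_mono fun ω h => le_trans (two_rpow_neg_anti m hab.le) h)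

theorem not_tendsto_of_specInf_lt (hpos : 0 < specInf μ) {a : ℝ} (ha : specInf μ < a) :
    ¬ Tendsto (fun m : ℕ => (μ {ω | (2 : ℝ) ^ (-((m : ℝ) * a)) ≤ cylP μ (pre ω m)}).toReal)
      atTop (nhds 0) := by
  intro h
  refine ha.not_ge (le_csSup ?_ h)
  by_contra hb
  rw [specInf, Real.sSup_of_not_bddAbove hb] at hpos
  exact hpos.false

variable [Fintype 𝒳] [DiscreteMeasurableSpace 𝒳] [IsProbabilityMeasure μ]

theorem tendsto_of_specSup_lt {a : ℝ} (ha : specSup μ < a) :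
    Tendsto (fun m : ℕ => (μ {ω | cylP μ (pre ω m) ≤ (2 : ℝ) ^ (-((m : ℝ) * a))}).toReal)
      atTop (nhds 0) := by
  set k := Fintype.card 𝒳 with hk
  have hne : Set.Nonempty {lam : ℝ | Tendsto (fun m : ℕ =>
      (μ {ω | cylP μ (pre ω m) ≤ (2 : ℝ) ^ (-((m : ℝ) * lam))}).toReal) atTop (nhds 0)} := by
    refine ⟨k + 1, squeeze_zero (fun m => ENNReal.toReal_nonneg) (fun m => ?_)
      (tendsto_two_rpow_neg one_pos)⟩
    rw [toReal_setOf_pre μ fun x : Fin m → 𝒳 => cylP μ x ≤ (2 : ℝ) ^ (-((m : ℝ) * (k + 1)))]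
    calc _ ≤ ∑ x ∈ Finset.univ.filter
            (fun x : Fin m → 𝒳 => cylP μ x ≤ (2 : ℝ) ^ (-((m : ℝ) * (k + 1)))),
            (2 : ℝ) ^ (-((m : ℝ) * (k + 1))) :=
          Finset.sum_le_sum fun x hx => (Finset.mem_filter.1 hx).2
      _ ≤ ∑ x : Fin m → 𝒳, (2 : ℝ) ^ (-((m : ℝ) * (k + 1))) :=
          Finset.sum_le_sum_of_subset_of_nonneg (Finset.subset_univ _) fun _ _ _ => by positivity
      _ = (k : ℝ) ^ m * (2 : ℝ) ^ (-((m : ℝ) * (k + 1))) := by simp [hk]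
      _ ≤ ((2 : ℝ) ^ k) ^ m * (2 : ℝ) ^ (-((m : ℝ) * (k + 1))) := by
          gcongr
          exact_mod_cast k.lt_two_pow_self.le
      _ = (2 : ℝ) ^ (-((m : ℝ) * 1)) := by
          rw [← Real.rpow_natCast, ← Real.rpow_natCast, ← Real.rpow_mul zero_le_two,
            ← Real.rpow_add two_pos]
          congr 1
          ring
  obtain ⟨b, hb, hba⟩ := exists_lt_of_csInf_lt hne ha
  refine squeeze_zero (fun m => ENNReal.toReal_nonneg) (fun m => ?_) hb
  exact ENNReal.toReal_mono (measure_ne_top _ _)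
    (measure_mono fun ω h => le_trans h (two_rpow_neg_anti m hba.le))

theorem specSup_nonneg : 0 ≤ specSup μ := by
  refine Real.sInf_nonneg fun a ha => ?_
  by_contra! hneg
  have h : ∀ m : ℕ, (μ {ω | cylP μ (pre ω m) ≤ (2 : ℝ) ^ (-((m : ℝ) * a))}).toReal = 1 := by
    intro m
    have huniv : {ω | cylP μ (pre ω m) ≤ (2 : ℝ) ^ (-((m : ℝ) * a))} = Set.univ := by
      refine Set.eq_univ_of_forall fun ω => (cylP_le_one μ _).trans ?_
      refine Real.one_le_rpow one_le_two ?_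
      nlinarith [(m.cast_nonneg : (0 : ℝ) ≤ m)]
    simp [huniv]
  rw [Set.mem_ofPred_eq, funext h] at ha
  exact one_ne_zero (tendsto_nhds_unique tendsto_const_nhds ha)

end Spectrum

section Achievability

variable [Fintype 𝒳] [LinearOrder 𝒳] [MeasurableSpace 𝒳] [DiscreteMeasurableSpace 𝒳]
  [Fintype 𝒴] [LinearOrder 𝒴] [MeasurableSpace 𝒴] [DiscreteMeasurableSpace 𝒴]
  (μ : Measure (ℕ → 𝒳)) [IsProbabilityMeasure μ] (ν : Measure (ℕ → 𝒴)) [IsProbabilityMeasure ν]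

theorem tendsto_not_intStopped (hX : 0 < specInf μ) (n : ℕ) :
    Tendsto (fun m => (μ {ω | ¬ IntStopped μ ν n m ω}).toReal) atTop (nhds 0) := by
  obtain ⟨g, hg, hgX⟩ := exists_between hX
  have h := (tendsto_of_lt_specInf μ hX hgX).add
    ((((tendsto_two_rpow_neg hg).const_mul
      ((Finset.univ : Finset (Fin n → 𝒴)).card : ℝ))).const_mul 4)
  simp only [mul_zero, add_zero] at h
  refine squeeze_zero (fun m => ENNReal.toReal_nonneg) (fun m => ?_) h
  simpa using toReal_not_intStopped_le μ ν n m (ε := (2 : ℝ) ^ (-((m : ℝ) * g)))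
    (by positivity) Finset.univ

theorem intAchievable_of_gt (hX : 0 < specInf μ) {R : ℝ} (hR : specSup ν / specInf μ < R) :
    IntAchievable μ ν R := by
  have hR0 : 0 < R := lt_of_le_of_lt (div_nonneg (specSup_nonneg ν) hX.le) hR
  obtain ⟨g, hg, hgX⟩ : ∃ g, specSup ν / R < g ∧ g < specInf μ := by
    refine exists_between ?_
    rw [div_lt_iff₀ hX] at hR
    rw [div_lt_iff₀ hR0]
    linarith
  have hg0 : 0 < g := lt_of_le_of_lt (div_nonneg (specSup_nonneg ν) hR0.le) hg
  rw [div_lt_iff₀ hR0] at hg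
  obtain ⟨b, hb, hbg⟩ := exists_between hg
  refine ⟨hR0.le, ?_⟩
  have hfloor : Tendsto (fun n : ℕ => ⌊(n : ℝ) * R⌋₊) atTop atTop :=
    tendsto_nat_floor_atTop.comp (tendsto_natCast_atTop_atTop.atTop_mul_const hR0)
  have h₁ := (tendsto_of_lt_specInf μ hX hgX).comp hfloor
  have h₂ := tendsto_of_specSup_lt ν hb
  have h₃ := (tendsto_two_rpow_neg (sub_pos.2 hbg)).const_mul (4 * (2 : ℝ) ^ g)
  have h := (h₁.add h₂).add h₃
  simp only [mul_zero, add_zero] at h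
  refine squeeze_zero (fun n => ENNReal.toReal_nonneg) (fun n => ?_) h
  set m := ⌊(n : ℝ) * R⌋₊ with hm
  set G : Finset (Fin n → 𝒴) :=
    Finset.univ.filter fun y => ¬ cylP ν y ≤ (2 : ℝ) ^ (-((n : ℝ) * b)) with hG
  refine (toReal_not_intStopped_le μ ν n m (ε := (2 : ℝ) ^ (-((m : ℝ) * g)))
    (by positivity) G).trans ?_
  refine add_le_add (add_le_add le_rfl (le_of_eq ?_)) ?_
  · rw [toReal_setOf_pre ν fun y : Fin n → 𝒴 => cylP ν y ≤ (2 : ℝ) ^ (-((n : ℝ) * b))]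
    refine Finset.sum_congr ?_ fun _ _ => rfl
    ext y
    simp [hG]
  · have hcard : (G.card : ℝ) ≤ (2 : ℝ) ^ ((n : ℝ) * b) := by
      have hle : (G.card : ℝ) * (2 : ℝ) ^ (-((n : ℝ) * b)) ≤ 1 := by
        rw [← sum_cylP ν n, ← nsmul_eq_mul, ← Finset.sum_const]
        refine (Finset.sum_le_sum fun y hy => (not_le.1 (Finset.mem_filter.1 hy).2).le).trans ?_
        exact Finset.sum_le_sum_of_subset_of_nonneg (Finset.subset_univ _)
          fun y _ _ => cylP_nonneg ν y
      rwa [Real.rpow_neg zero_le_two, ← div_eq_mul_inv, div_le_one (by positivity)] at hle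
    have hfl : (n : ℝ) * R < m + 1 := Nat.lt_floor_add_one _
    calc 4 * ((G.card : ℝ) * (2 : ℝ) ^ (-((m : ℝ) * g)))
        ≤ 4 * ((2 : ℝ) ^ ((n : ℝ) * b) * (2 : ℝ) ^ (-((m : ℝ) * g))) := by gcongr
      _ = 4 * (2 : ℝ) ^ ((n : ℝ) * b + -((m : ℝ) * g)) := by rw [Real.rpow_add two_pos]
      _ ≤ 4 * (2 : ℝ) ^ (g + -((n : ℝ) * (g * R - b))) := by
          refine mul_le_mul_of_nonneg_left
            (Real.rpow_le_rpow_of_exponent_le one_le_two ?_) zero_le_four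
          nlinarith
      _ = 4 * (2 : ℝ) ^ g * (2 : ℝ) ^ (-((n : ℝ) * (g * R - b))) := by
          rw [Real.rpow_add two_pos, mul_assoc]

theorem IntAchievable.achievable (hX : 0 < specInf μ) {R : ℝ} (h : IntAchievable μ ν R) :
    Achievable μ ν R := by
  refine ⟨h.1, intAlg μ ν, fun n => valid_intAlg μ ν n (tendsto_not_intStopped μ ν hX n),
    squeeze_zero (fun n => ENNReal.toReal_nonneg) (fun n => ?_) h.2⟩
  refine ENNReal.toReal_mono (measure_ne_top _ _) (measure_mono fun ω hω => ?_)
  exact (intAlg_preL_eq_none_iff μ ν n _ ω).1 (hω _ le_rfl)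

end Achievability

section Converse

variable [MeasurableSpace 𝒳] [Fintype 𝒴] [MeasurableSpace 𝒴] [DiscreteMeasurableSpace 𝒴]
  (μ : Measure (ℕ → 𝒳)) [IsProbabilityMeasure μ] (ν : Measure (ℕ → 𝒴)) [IsProbabilityMeasure ν]

/-- A valid algorithm stopping within `m` symbols on a coin string of probability at least `c`
outputs a target string of probability at least `c`. -/
theorem Valid.toReal_le {n : ℕ} {φ : List 𝒳 → Option (Fin n → 𝒴)}
    (hφ : Valid μ (fun y : Fin n → 𝒴 => cylP ν y) φ) (m : ℕ) (c : ℝ) :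
    (μ {ω | c ≤ cylP μ (pre ω m)}).toReal ≤
      (μ {ω | ∀ i ≤ m, φ (preL ω i) = none}).toReal +
        (ν {ω | c ≤ cylP ν (pre ω n)}).toReal := by
  set E : (Fin n → 𝒴) → Set (ℕ → 𝒳) := fun y =>
    {ω | ∃ i : ℕ, φ (preL ω i) = some y ∧ ∀ j < i, φ (preL ω j) = none} with hE
  set S : Finset (Fin n → 𝒴) := Finset.univ.filter fun y => c ≤ cylP ν y with hS
  have hsub : {ω | c ≤ cylP μ (pre ω m)} ⊆
      {ω | ∀ i ≤ m, φ (preL ω i) = none} ∪ ⋃ y ∈ S, E y := by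
    intro ω hω
    by_cases h : ∀ i ≤ m, φ (preL ω i) = none
    · exact Or.inl h
    · push Not at h
      obtain ⟨y, hy⟩ := Option.ne_none_iff_exists'.1 (Nat.find_spec h).2
      have him := (Nat.find_spec h).1
      have hmin : ∀ j < Nat.find h, φ (preL ω j) = none := fun j hj =>
        not_not.1 fun hne => Nat.find_min h hj ⟨hj.le.trans him, hne⟩
      refine Or.inr (Set.mem_biUnion (x := y) ?_ ⟨Nat.find h, hy, hmin⟩)
      simp only [hS, Finset.coe_filter, Finset.mem_univ, true_and, Set.mem_ofPred_eq]
      refine le_trans hω (le_trans ?_ (hφ y).le)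
      rw [cylP, setOf_forall_eq_pre]
      refine ENNReal.toReal_mono (measure_ne_top _ _) (measure_mono fun ω' hω' => ?_)
      refine ⟨Nat.find h, by rw [preL_congr him hω', hy], fun j hj => ?_⟩
      rw [preL_congr (hj.le.trans him) hω', hmin j hj]
  have h₁ := (measure_mono hsub).trans <| (measure_union_le _ _).trans <|
    add_le_add_right (measure_biUnion_finset_le (μ := μ) S E) _
  have hfin : ∑ y ∈ S, μ (E y) ≠ ∞ := ENNReal.sum_ne_top.2 fun y _ => measure_ne_top _ _
  have h₂ := ENNReal.toReal_mono (ENNReal.add_ne_top.2 ⟨measure_ne_top _ _, hfin⟩) h₁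
  rw [ENNReal.toReal_add (measure_ne_top _ _) hfin,
    ENNReal.toReal_sum fun y _ => measure_ne_top _ _] at h₂
  rw [toReal_setOf_pre ν fun y : Fin n → 𝒴 => c ≤ cylP ν y]
  exact h₂.trans (add_le_add le_rfl (Finset.sum_le_sum fun y _ => (hφ y).le))

theorem le_of_achievable (hX : 0 < specInf μ) {R : ℝ} (hR : Achievable μ ν R) :
    specInf ν / specInf μ ≤ R := by
  obtain ⟨hR0, φ, hφ, hlim⟩ := hR
  by_contra! hlt
  obtain ⟨r, hRr, hr⟩ := exists_between hlt
  have hr0 : 0 < r := hR0.trans_lt hRr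
  have hY : 0 < specInf ν := by
    rw [lt_div_iff₀ hX] at hr
    exact (mul_pos hr0 hX).trans hr
  obtain ⟨a, haX, har⟩ : ∃ a, specInf μ < a ∧ a < specInf ν / r := by
    refine exists_between ?_
    rw [lt_div_iff₀ hX] at hr
    rw [lt_div_iff₀ hr0]
    linarith
  rw [lt_div_iff₀ hr0] at har
  obtain ⟨b, hab, hb⟩ := exists_between har
  have ha0 : 0 < a := hX.trans haX
  refine not_tendsto_of_specInf_lt μ hX haX ?_
  have hfloor : Tendsto (fun m : ℕ => ⌊(m : ℝ) / r⌋₊) atTop atTop :=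
    tendsto_nat_floor_atTop.comp (tendsto_natCast_atTop_atTop.atTop_div_const hr0)
  have h := (hlim.comp hfloor).add ((tendsto_of_lt_specInf ν hY hb).comp hfloor)
  rw [add_zero] at h
  have hlarge : ∀ᶠ m : ℕ in atTop, a * r ≤ (⌊(m : ℝ) / r⌋₊ : ℝ) * (b - a * r) :=
    ((tendsto_natCast_atTop_atTop.comp hfloor).atTop_mul_const
      (sub_pos.2 hab)).eventually_ge_atTop _
  refine squeeze_zero' (Eventually.of_forall fun m => ENNReal.toReal_nonneg) ?_ h
  filter_upwards [hlarge] with m hm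
  set n := ⌊(m : ℝ) / r⌋₊ with hn
  have hnr : (n : ℝ) * r ≤ m := by
    rw [← le_div_iff₀ hr0]
    exact Nat.floor_le (by positivity)
  have hnr' : (m : ℝ) < (n + 1) * r := by
    rw [← div_lt_iff₀ hr0]
    exact Nat.lt_floor_add_one _
  refine (Valid.toReal_le μ ν (hφ n) m _).trans (add_le_add ?_ ?_)
  · refine ENNReal.toReal_mono (measure_ne_top _ _) (measure_mono fun ω hω i hi => ?_)
    refine hω i (hi.trans (Nat.floor_le_of_le (le_trans ?_ hnr)))
    gcongr
  · refine ENNReal.toReal_mono (measure_ne_top _ _) (measure_mono fun ω hω => ?_)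
    change (2 : ℝ) ^ (-((n : ℝ) * b)) ≤ cylP ν (pre ω n)
    refine le_trans ?_ hω
    refine Real.rpow_le_rpow_of_exponent_le one_le_two (neg_le_neg ?_)
    nlinarith

end Converse

end RNG

/-- **Corollary 3, target with one-point spectrum.** If `H̄(Y) = H̲(Y) = H(Y)` and
`H̲(X) > 0`, then the interval algorithm is asymptotically optimal for the
overflow-probability criterion: `R⋆_int(X,Y) = R⋆(X,Y) = H(Y)/H̲(X)`. -/
theorem one_point_target_spectrum_Rstar
    {𝒳 𝒴 : Type*} [Fintype 𝒳] [LinearOrder 𝒳] [MeasurableSpace 𝒳] [DiscreteMeasurableSpace 𝒳]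
    [Fintype 𝒴] [LinearOrder 𝒴] [MeasurableSpace 𝒴] [DiscreteMeasurableSpace 𝒴]
    (μ : Measure (ℕ → 𝒳)) [IsProbabilityMeasure μ]
    (ν : Measure (ℕ → 𝒴)) [IsProbabilityMeasure ν]
    (hsup : specSup ν = entRate ν) (hinf : specInf ν = entRate ν)
    (hX : 0 < specInf μ) :
    Rint μ ν = entRate ν / specInf μ ∧ Rstar μ ν = entRate ν / specInf μ := by
  have hach : ∀ R, entRate ν / specInf μ < R → IntAchievable μ ν R := fun R hR =>
    intAchievable_of_gt μ ν hX (by rwa [hsup])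
  have hconv : ∀ R, Achievable μ ν R → entRate ν / specInf μ ≤ R := fun R hR => by
    rw [← hinf]
    exact le_of_achievable μ ν hX hR
  constructor
  · refine csInf_eq_of_forall_ge_of_forall_gt_exists_lt ⟨_, hach _ (lt_add_one _)⟩
      (fun R hR => hconv R (IntAchievable.achievable μ ν hX hR)) fun w hw => ?_
    obtain ⟨R, hR, hRw⟩ := exists_between hw
    exact ⟨R, hach R hR, hRw⟩
  · refine csInf_eq_of_forall_ge_of_forall_gt_exists_lt
      ⟨_, IntAchievable.achievable μ ν hX (hach _ (lt_add_one _))⟩ hconv fun w hw => ?_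
    obtain ⟨R, hR, hRw⟩ := exists_between hw
    exact ⟨R, IntAchievable.achievable μ ν hX (hach R hR), hRw⟩
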